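/- arXiv:1112.6061 — 2 statements merged into one kernel-verified Lean document; each statement's English description precedes it below -/
import Mathlib

section
/- Let r ≥ k ≥ 2 and q > 0 be integers. Then there are unique integers a, b, and m such that q = C(a, k)_r + C(b, k-1)_{r-1} + m, with a − floor(a/r) > b and C(b − floor(b/(r-1)), k-2)_{r-2} > m ≥ 0. -/
/-- `tc n k r` : the number of cliques on `k` vertices in the Turán graph `T_{n,r}`
(the complete multipartite graph on `n` vertices whose `r` parts are as equal as possible).
This is the quantity `C(n,k)_r`. -/
noncomputable def tc (n k r : ℕ) : ℕ := ((SimpleGraph.turanGraph n r).cliqueSet k).ncard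

/-- The number of `k`-element subsets of `S` on which the colouring `c` is injective. -/
noncomputable def rainbowCount {α β : Type*} (S : Finset α) (c : α → β) (k : ℕ) : ℕ :=
  {t : Finset α | t ⊆ S ∧ t.card = k ∧ Set.InjOn c t}.ncard

theorem finite_rainbow {α β : Type*} (S : Finset α) (c : α → β) (k : ℕ) :
    {t : Finset α | t ⊆ S ∧ t.card = k ∧ Set.InjOn c t}.Finite :=
  S.powerset.finite_toSet.subset fun t ht => by simpa using ht.1

theorem rainbowCount_image {α β γ δ : Type*} [DecidableEq γ] (S : Finset α) (c : α → β)
    (c' : γ → δ) (φ : α → γ) (k : ℕ) (hφ : Set.InjOn φ S)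
    (hc : ∀ x ∈ S, ∀ y ∈ S, (c' (φ x) = c' (φ y) ↔ c x = c y)) :
    rainbowCount (S.image φ) c' k = rainbowCount S c k := by
  symm
  refine Set.ncard_congr (fun t _ => t.image φ) ?_ ?_ ?_
  · rintro t ⟨htS, htk, hti⟩
    refine ⟨Finset.image_subset_image htS, ?_, ?_⟩
    · rw [Finset.card_image_of_injOn (hφ.mono (by exact_mod_cast htS)), htk]
    · intro x hx y hy hxy
      simp only [Finset.coe_image, Set.mem_image, Finset.mem_coe] at hx hy
      obtain ⟨x, hx, rfl⟩ := hx
      obtain ⟨y, hy, rfl⟩ := hy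
      rw [hti hx hy ((hc x (htS hx) y (htS hy)).1 hxy)]
  · rintro s t ⟨hs, -, -⟩ ⟨ht, -, -⟩ hst
    exact Finset.image_injOn_powerset_of_injOn hφ (by simpa using hs) (by simpa using ht) hst
  · rintro t ⟨htS, htk, hti⟩
    obtain ⟨s, hsS, rfl⟩ := Finset.subset_image_iff.1 htS
    have hsS' : s ⊆ S := by exact_mod_cast hsS
    refine ⟨s, ⟨hsS', ?_, ?_⟩, rfl⟩
    · rwa [Finset.card_image_of_injOn (hφ.mono hsS)] at htk
    · intro x hx y hy hxy
      exact hφ (hsS hx) (hsS hy) (hti (by simpa using ⟨x, hx, rfl⟩) (by simpa using ⟨y, hy, rfl⟩)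
        ((hc x (hsS' hx) y (hsS' hy)).2 hxy))

theorem rainbowCount_insert {α β : Type*} [DecidableEq α] [DecidableEq β] (S : Finset α)
    (c : α → β) (k : ℕ) {x : α} (hx : x ∉ S) :
    rainbowCount (insert x S) c (k + 1) =
      rainbowCount S c (k + 1) + rainbowCount (S.filter fun y => c y ≠ c x) c k := by
  have hmem : ∀ t : Finset α, t ⊆ S.filter (fun y => c y ≠ c x) → x ∉ t :=
    fun t ht hxt => hx (Finset.filter_subset _ _ (ht hxt))
  have himage : ((fun t => insert x t) ''
      {t : Finset α | t ⊆ S.filter (fun y => c y ≠ c x) ∧ t.card = k ∧ Set.InjOn c t}).ncard =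
      rainbowCount (S.filter fun y => c y ≠ c x) c k := by
    refine Set.InjOn.ncard_image ?_
    rintro s ⟨hs, -, -⟩ t ⟨ht, -, -⟩ hst
    simpa [Finset.erase_insert, hmem s hs, hmem t ht] using congrArg (fun u => u.erase x) hst
  rw [← himage, rainbowCount, rainbowCount, ← Set.ncard_union_eq ?_ (finite_rainbow _ _ _)
    ((finite_rainbow _ _ _).image _)]
  · congr 1
    ext t
    constructor
    · rintro ⟨htS, htk, hti⟩
      by_cases hxt : x ∈ t
      · refine Or.inr ⟨t.erase x, ⟨?_, ?_, ?_⟩, Finset.insert_erase hxt⟩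
        · intro y hy
          obtain ⟨hyx, hyt⟩ := Finset.mem_erase.1 hy
          refine Finset.mem_filter.2 ⟨(Finset.mem_insert.1 (htS hyt)).resolve_left hyx, ?_⟩
          exact fun h => hyx (hti hyt hxt h)
        · rw [Finset.card_erase_of_mem hxt, htk, Nat.add_sub_cancel]
        · exact hti.mono (by exact_mod_cast Finset.erase_subset x t)
      · exact Or.inl ⟨(Finset.subset_insert_iff_of_notMem hxt).1 htS, htk, hti⟩
    · rintro (⟨htS, htk, hti⟩ | ⟨t, ⟨htS, htk, hti⟩, rfl⟩)
      · exact ⟨htS.trans (Finset.subset_insert _ _), htk, hti⟩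
      · refine ⟨Finset.insert_subset_insert _ (htS.trans (Finset.filter_subset _ _)), ?_, ?_⟩
        · rw [Finset.card_insert_of_notMem (hmem t htS), htk]
        · rw [Finset.coe_insert, Set.injOn_insert (by simpa using hmem t htS)]
          refine ⟨hti, ?_⟩
          rintro ⟨y, hy, hyx⟩
          exact (Finset.mem_filter.1 (htS hy)).2 hyx
  · rw [Set.disjoint_left]
    rintro _ ⟨htS, -, -⟩ ⟨t, -, rfl⟩
    exact hx (htS (Finset.mem_insert_self _ _))

theorem tc_eq_rainbowCount (n k r : ℕ) :
    tc n k r = rainbowCount (Finset.range n) (fun v => v % r) k := by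
  have h : Finset.range n = (Finset.univ : Finset (Fin n)).image Fin.val := by
    ext x
    simp [Fin.exists_iff]
  rw [h, rainbowCount_image Finset.univ (fun v : Fin n => (v : ℕ) % r) _ _ k
    Fin.val_injective.injOn (fun _ _ _ _ => Iff.rfl), tc, rainbowCount]
  congr 1
  ext t
  simp only [SimpleGraph.mem_cliqueSet_iff, SimpleGraph.isNClique_iff, SimpleGraph.isClique_iff,
    Set.mem_ofPred_eq, Finset.subset_univ, true_and, and_comm (b := t.card = k)]
  refine and_congr_right fun _ => ?_
  constructor
  · intro ht x hx y hy hxy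
    by_contra hne
    exact ht hx hy hne hxy
  · intro ht x hx y hy hne hxy
    exact hne (ht hx hy hxy)

/-- The positive integer that comes after exactly `e` positive integers not divisible by `r + 1`
and is not divisible by `r + 1` itself, in terms of quotient and remainder of `e` by `r`. -/
theorem add_div_add_one_eq (r e : ℕ) :
    e + e / r + 1 = (r + 1) * (e / r) + (e % r + 1) := by
  have := Nat.div_add_mod e r
  linarith

theorem add_div_add_one_mod {r : ℕ} (hr : 0 < r) (e : ℕ) :
    (e + e / r + 1) % (r + 1) = e % r + 1 := by
  rw [add_div_add_one_eq, Nat.mul_add_mod]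
  exact Nat.mod_eq_of_lt (Nat.succ_lt_succ (Nat.mod_lt _ hr))

theorem sub_div_succ_eq (r n : ℕ) :
    n - n / (r + 1) = r * (n / (r + 1)) + n % (r + 1) := by
  have := Nat.div_add_mod n (r + 1)
  rw [Nat.sub_eq_iff_eq_add (Nat.div_le_self _ _)]
  linarith

theorem add_div_add_one_le {r n e : ℕ} (hr : 0 < r) (he : e < n - n / (r + 1)) :
    e + e / r + 1 ≤ n := by
  have hn := Nat.div_add_mod n (r + 1)
  have hT : n % (r + 1) < r + 1 := Nat.mod_lt _ r.succ_pos
  have hs : e % r < r := Nat.mod_lt _ hr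
  have hd := Nat.div_add_mod e r
  rw [sub_div_succ_eq] at he
  rw [add_div_add_one_eq]
  generalize n / (r + 1) = Q at *
  generalize n % (r + 1) = T at *
  generalize e / r = a at *
  generalize e % r = s at *
  rcases lt_trichotomy a Q with h | rfl | h
  · nlinarith
  · nlinarith
  · nlinarith

theorem range_filter_mod_ne (r n : ℕ) :
    (Finset.range n).filter (fun y => y % (r + 1) ≠ n % (r + 1)) =
      (Finset.range (n - n / (r + 1))).image fun e => n - (e + e / r + 1) := by
  ext y
  simp only [Finset.mem_filter, Finset.mem_range, Finset.mem_image]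
  rcases Nat.eq_zero_or_pos r with rfl | hr
  · simp [Nat.mod_one]
  constructor
  · rintro ⟨hy, hne⟩
    obtain ⟨d, rfl⟩ := Nat.exists_eq_add_of_le hy.le
    have hd0 : d % (r + 1) ≠ 0 := fun h => hne (by rw [Nat.add_mod, h]; simp)
    obtain ⟨s, hs⟩ := Nat.exists_eq_succ_of_ne_zero hd0
    have hsr : s < r := by have := Nat.mod_lt d (Nat.add_one_pos r); omega
    have hd := Nat.div_add_mod d (r + 1)
    have hdiv : (r * (d / (r + 1)) + s) / r = d / (r + 1) := by
      rw [Nat.mul_add_div hr, Nat.div_eq_of_lt hsr, add_zero]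
    refine ⟨r * (d / (r + 1)) + s, ?_, ?_⟩
    · have hn := Nat.div_add_mod (y + d) (r + 1)
      have hT := Nat.mod_lt (y + d) r.succ_pos
      have hle : d / (r + 1) ≤ (y + d) / (r + 1) := Nat.div_le_div_right (by omega)
      rw [sub_div_succ_eq]
      rw [hs] at hd
      generalize (y + d) / (r + 1) = Q at *
      generalize (y + d) % (r + 1) = T at *
      generalize d / (r + 1) = a at *
      rcases hle.lt_or_eq with h | rfl
      · nlinarith
      · nlinarith
    · rw [hdiv]
      have : r * (d / (r + 1)) + s + d / (r + 1) + 1 = d := by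
        rw [hs] at hd
        linarith
      rw [this, Nat.add_sub_cancel]
  · rintro ⟨e, he, rfl⟩
    have hle := add_div_add_one_le hr he
    refine ⟨Nat.sub_lt ((Nat.succ_pos _).trans_le hle) (Nat.succ_pos _), fun h => ?_⟩
    have hmod := add_div_add_one_mod hr e
    obtain ⟨x, hx⟩ := Nat.exists_eq_add_of_le hle
    rw [hx, Nat.add_sub_cancel_left] at h
    have h' : x + 0 ≡ x + (e + e / r + 1) [MOD r + 1] := by
      rw [add_comm x (_ + 1)]
      exact h
    have := Nat.ModEq.add_left_cancel' x h'
    rw [Nat.ModEq, hmod] at this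
    simp at this

/-- Deleting a vertex from a largest part of `T_{n+1,r+1}` leaves `T_{n,r+1}`, and its
neighbourhood is `T_{n-⌊n/(r+1)⌋,r}`. -/
theorem tc_succ (n k r : ℕ) :
    tc (n + 1) (k + 1) (r + 1) = tc n (k + 1) (r + 1) + tc (n - n / (r + 1)) k r := by
  simp only [tc_eq_rainbowCount]
  rw [Finset.range_add_one, rainbowCount_insert _ _ _ Finset.notMem_range_self,
    range_filter_mod_ne]
  congr 1
  rcases Nat.eq_zero_or_pos r with rfl | hr
  · simp only [zero_add, Nat.div_one, Nat.sub_self, Finset.range_zero]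
    refine rainbowCount_image _ _ _ _ _ (by simp) (by simp)
  refine rainbowCount_image _ _ _ _ _ ?_ ?_
  · intro x hx y hy hxy
    simp only [Finset.coe_range, Set.mem_Iio] at hx hy
    have h1 := add_div_add_one_le hr hx
    have h2 := add_div_add_one_le hr hy
    have h3 : x + x / r = y + y / r := by
      dsimp only at hxy
      omega
    rcases le_total x y with h | h
    · have := Nat.div_le_div_right (c := r) h
      omega
    · have := Nat.div_le_div_right (c := r) h
      omega
  · intro x hx y hy
    have h1 := add_div_add_one_le hr (Finset.mem_range.1 hx)
    have h2 := add_div_add_one_le hr (Finset.mem_range.1 hy)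
    have h3 := add_div_add_one_mod hr x
    have h4 := add_div_add_one_mod hr y
    have h5 : x % r = y % r ↔ x + x / r + 1 ≡ y + y / r + 1 [MOD r + 1] := by
      rw [Nat.ModEq, h3, h4, Nat.add_right_cancel_iff]
    have h6 : n - (x + x / r + 1) + (x + x / r + 1) ≡
        n - (y + y / r + 1) + (y + y / r + 1) [MOD r + 1] := by
      rw [Nat.sub_add_cancel h1, Nat.sub_add_cancel h2]
    rw [h5]
    exact ⟨fun h => Nat.ModEq.add_left_cancel h h6, fun h => Nat.ModEq.add_right_cancel h h6⟩

theorem tc_zero_succ (k r : ℕ) : tc 0 (k + 1) r = 0 := by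
  rw [tc_eq_rainbowCount, rainbowCount, Set.ncard_eq_zero (finite_rainbow _ _ _)]
  ext t
  simp only [Finset.range_zero, Finset.subset_empty, Set.mem_ofPred_eq, Set.mem_empty_iff_false,
    iff_false]
  rintro ⟨rfl, h, -⟩
  simp at h

theorem tc_pos {n k r : ℕ} (hkn : k ≤ n) (hkr : k ≤ r) : 0 < tc n k r := by
  rw [tc_eq_rainbowCount, rainbowCount, Set.ncard_pos (finite_rainbow _ _ _)]
  refine ⟨Finset.range k, by simpa using hkn, Finset.card_range k, ?_⟩
  intro x hx y hy hxy
  simp only [Finset.coe_range, Set.mem_Iio] at hx hy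
  simpa [Nat.mod_eq_of_lt (hx.trans_le hkr), Nat.mod_eq_of_lt (hy.trans_le hkr)] using hxy

theorem tc_monotone (k r : ℕ) : Monotone fun n => tc n (k + 1) (r + 1) :=
  monotone_nat_of_le_succ fun n => by
    rw [tc_succ]
    exact Nat.le_add_right _ _

theorem le_tc_add {k r : ℕ} (hkr : k ≤ r) (j : ℕ) : j ≤ tc (k + j) (k + 1) (r + 1) := by
  induction j with
  | zero => exact Nat.zero_le _
  | succ j ih =>
    rw [← add_assoc, tc_succ]
    have hpos : 0 < tc (k + j - (k + j) / (r + 1)) k r := by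
      refine tc_pos ?_ hkr
      have hd := Nat.div_add_mod (k + j) (r + 1)
      rw [sub_div_succ_eq]
      rcases Nat.eq_zero_or_pos ((k + j) / (r + 1)) with h | h
      · rw [h] at hd ⊢
        omega
      · exact (hkr.trans (Nat.le_mul_of_pos_right r h)).trans (Nat.le_add_right _ _)
    omega

theorem exists_tc_le_lt {k r : ℕ} (hkr : k ≤ r) (q : ℕ) :
    ∃ n, tc n (k + 1) (r + 1) ≤ q ∧ q < tc (n + 1) (k + 1) (r + 1) := by
  classical
  have hex : ∃ n, q < tc n (k + 1) (r + 1) := ⟨_, le_tc_add hkr (q + 1)⟩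
  obtain ⟨n, hn⟩ : ∃ n, Nat.find hex = n + 1 := Nat.exists_eq_succ_of_ne_zero fun h => by
    have := Nat.find_spec hex
    rw [h, tc_zero_succ] at this
    exact Nat.not_lt_zero _ this
  refine ⟨n, not_lt.1 (Nat.find_min hex (by omega)), ?_⟩
  rw [← hn]
  exact Nat.find_spec hex

theorem Monotone.nat_eq_of_le_of_lt {f : ℕ → ℕ} (hf : Monotone f) {q m n : ℕ}
    (hm : f m ≤ q) (hm' : q < f (m + 1)) (hn : f n ≤ q) (hn' : q < f (n + 1)) : m = n := by
  have h1 := hf.reflect_lt (hm.trans_lt hn')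
  have h2 := hf.reflect_lt (hn.trans_lt hm')
  omega

/-- Let `r ≥ k ≥ 2` and `q > 0` be integers.  Then there are unique
integers `a`, `b`, `m` such that `q = C(a, k)_r + C(b, k-1)_{r-1} + m`, with
`a − ⌊a/r⌋ > b` and `C(b − ⌊b/(r-1)⌋, k-2)_{r-2} > m ≥ 0`. -/
theorem stmt_10 (r k q : ℕ) (hk : 2 ≤ k) (hkr : k ≤ r) (hq : 0 < q) :
    ∃! abm : ℕ × ℕ × ℕ,
      q = tc abm.1 k r + tc abm.2.1 (k - 1) (r - 1) + abm.2.2 ∧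
      abm.2.1 < abm.1 - abm.1 / r ∧
      abm.2.2 < tc (abm.2.1 - abm.2.1 / (r - 1)) (k - 2) (r - 2) := by
  obtain ⟨k, rfl⟩ := Nat.exists_eq_add_of_le' hk
  obtain ⟨r, rfl⟩ := Nat.exists_eq_add_of_le' (hk.trans hkr)
  have hkr' : k ≤ r := by omega
  simp only [Nat.add_sub_cancel, show ∀ x, x + 2 - 1 = x + 1 from fun _ => rfl]
  have hbound : ∀ {a b m : ℕ}, b < a - a / (r + 2) → m < tc (b - b / (r + 1)) k r →
      tc b (k + 1) (r + 1) + m < tc (b + 1) (k + 1) (r + 1) ∧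
      tc a (k + 2) (r + 2) + tc b (k + 1) (r + 1) + m < tc (a + 1) (k + 2) (r + 2) := by
    intro a b m hb hm
    have h1 := tc_succ b k r
    have h2 := tc_succ a (k + 1) (r + 1)
    have h3 : tc (b + 1) (k + 1) (r + 1) ≤ tc (a - a / (r + 2)) (k + 1) (r + 1) :=
      tc_monotone k r hb
    constructor
    · omega
    · simp only [add_assoc, Nat.reduceAdd] at h2
      omega
  have hmono : Monotone fun n => tc n (k + 2) (r + 2) := tc_monotone (k + 1) (r + 1)
  obtain ⟨a, ha, ha'⟩ := exists_tc_le_lt (Nat.succ_le_succ hkr') q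
  obtain ⟨b, hb, hb'⟩ := exists_tc_le_lt hkr' (q - tc a (k + 2) (r + 2))
  have hsa := tc_succ a (k + 1) (r + 1)
  have hsb := tc_succ b k r
  simp only [Nat.succ_eq_add_one, add_assoc, Nat.reduceAdd] at ha ha' hsa
  have hba : b < a - a / (r + 2) := by
    refine (tc_monotone k r).reflect_lt ?_
    omega
  refine ⟨(a, b, q - tc a (k + 2) (r + 2) - tc b (k + 1) (r + 1)), ⟨?_, hba, ?_⟩, ?_⟩
  · dsimp only
    omega
  · dsimp only
    omega
  · rintro ⟨a₁, b₁, m₁⟩ ⟨h1, h2, h3⟩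
    dsimp only at h1 h2 h3
    obtain ⟨h4, h5⟩ := hbound h2 h3
    obtain rfl : a₁ = a := hmono.nat_eq_of_le_of_lt (q := q)
      (by omega) (by omega) ha ha'
    obtain rfl : b₁ = b := (tc_monotone k r).nat_eq_of_le_of_lt
      (q := q - tc a₁ (k + 2) (r + 2)) (by omega) (by omega) hb hb'
    simp only [Prod.mk.injEq, true_and]
    omega
end

section
/- Let r, k, p, v, and w be positive integers with r ≥ k > p. Write v = C(a, k)_r + C(b, k-1)_{r-1} + m with a − floor(a/r) > b and C(b − floor(b/(r-1)), k-2)_{r-2} > m ≥ 0 (the unique such representation). If w ≥ C(a, p)_r + C(b, p-1)_{r-1} + d_{p,r}^k(m), then there exists a finite simple graph G with no clique on r+1 vertices whose number of cliques on k vertices is exactly v and whose number of cliques on p vertices is exactly w (equivalently, a flag complex of dimension at most r-1 with f_{k-1} = v and f_{p-1} = w). -/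
/-- `jkr r k m` : for `m > 0` (and `r ≥ k > 1`), the unique `n` with
`C(n, k-1)_{r-1} ≤ m < C(n+1, k-1)_{r-1}`. -/
noncomputable def jkr (r k m : ℕ) : ℕ :=
  Nat.findGreatest (fun n => tc n (k - 1) (r - 1) ≤ m) ((m + 2) * r)

/-- The function `d_{p,r}^k`, defined recursively by `d_{p,r}^k(0) = 0` and
`d_{p,r}^k(m) = C(j_k^r(m), p-1)_{r-1} + d_{p,r}^k(m - C(j_k^r(m), k-1)_{r-1})` for `m > 0`.
(In the regime of interest, `r ≥ k > p ≥ 1`, one always has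
`tc (jkr r k m) (k-1) (r-1) ≥ 1`, so the `max 1` below is the identity and this definition
agrees with the stated recursion; the `max 1` merely guarantees termination in degenerate
cases such as `r < k`.) -/
noncomputable def dprk (p r k : ℕ) : ℕ → ℕ
  | 0 => 0
  | m + 1 =>
    tc (jkr r k (m + 1)) (p - 1) (r - 1) +
      dprk p r k (m + 1 - max 1 (tc (jkr r k (m + 1)) (k - 1) (r - 1)))
decreasing_by
  have := Nat.le_max_left 1 (tc (jkr r k (m + 1)) (k - 1) (r - 1))
  omega

open SimpleGraph in
/-- The cliques of `G` supported on the image of an induced embedding of `H` are exactly the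
images of the cliques of `H`. -/
theorem ncard_cliqueSet_subset_range {V W : Type} {G : SimpleGraph V} {H : SimpleGraph W}
    (f : H ↪g G) (k : ℕ) :
    {s ∈ G.cliqueSet k | (s : Set V) ⊆ Set.range f}.ncard = (H.cliqueSet k).ncard := by
  classical
  have hinj : Function.Injective (fun s : Finset W => s.map f.toEmbedding) :=
    Finset.map_injective _
  rw [← Set.ncard_image_of_injective (H.cliqueSet k) hinj]
  congr 1
  ext s
  simp only [Set.mem_ofPred_eq, Set.mem_image, mem_cliqueSet_iff, isNClique_iff]
  constructor
  · rintro ⟨⟨hs, hk⟩, hr⟩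
    obtain ⟨t, rfl⟩ : ∃ t : Finset W, t.map f.toEmbedding = s := by
      rw [← Set.image_univ] at hr
      obtain ⟨t, -, ht⟩ := Finset.subset_set_image_iff.mp hr
      exact ⟨t, by rw [Finset.map_eq_image]; exact ht⟩
    refine ⟨t, ⟨fun x hx y hy hxy => ?_, by simpa using hk⟩, rfl⟩
    exact f.map_adj_iff.mp (hs (by simpa using hx) (by simpa using hy) (f.injective.ne hxy))
  · rintro ⟨t, ⟨ht, hk⟩, rfl⟩
    refine ⟨⟨?_, by simpa using hk⟩, ?_⟩
    · intro x hx y hy hxy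
      simp only [Finset.coe_map, Set.mem_image, Finset.mem_coe] at hx hy
      obtain ⟨x, hx, rfl⟩ := hx
      obtain ⟨y, hy, rfl⟩ := hy
      exact f.map_adj_iff.mpr (ht hx hy fun h => hxy (h ▸ rfl))
    · intro x hx
      simp only [Finset.coe_map, Set.mem_image, Finset.mem_coe] at hx
      obtain ⟨x, -, rfl⟩ := hx
      exact ⟨x, rfl⟩

/-- The graph obtained from `G` by adding one vertex with neighbourhood `S`. -/
def SimpleGraph.addVertex {V : Type} (G : SimpleGraph V) (S : Set V) :
    SimpleGraph (Option V) where
  Adj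
    | none, none => False
    | none, some v => v ∈ S
    | some u, none => u ∈ S
    | some u, some v => G.Adj u v
  symm := ⟨by
    rintro (_ | u) (_ | v) h
    · exact h
    · exact h
    · exact h
    · exact G.adj_symm h⟩
  loopless := ⟨by
    rintro (_ | u) h
    · exact h
    · exact G.irrefl h⟩

/-- The inclusion of `G` into `G.addVertex S`. -/
def SimpleGraph.someEmbedding {V : Type} (G : SimpleGraph V) (S : Set V) :
    G ↪g G.addVertex S where
  toFun := some
  inj' := Option.some_injective V
  map_rel_iff' := Iff.rfl

open SimpleGraph in
theorem ncard_cliqueSet_addVertex {V : Type} [Finite V] (G : SimpleGraph V) (S : Set V) (k : ℕ) :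
    ((G.addVertex S).cliqueSet (k + 1)).ncard =
      (G.cliqueSet (k + 1)).ncard + {s ∈ G.cliqueSet k | (s : Set V) ⊆ S}.ncard := by
  classical
  have hinj : Function.Injective (fun s : Finset V => s.insertNone) :=
    Finset.insertNone.injective
  rw [← ncard_cliqueSet_subset_range (G.someEmbedding S) (k + 1),
    ← Set.ncard_image_of_injective {s ∈ G.cliqueSet k | (s : Set V) ⊆ S} hinj,
    ← Set.ncard_union_eq _ (Set.toFinite _) (Set.toFinite _)]
  · congr 1
    ext s
    simp only [Set.mem_union, Set.mem_ofPred_eq, Set.mem_image, mem_cliqueSet_iff, isNClique_iff]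
    constructor
    · rintro ⟨hs, hk⟩
      by_cases hn : none ∈ s
      · right
        have hi : (s.eraseNone).insertNone = s := by
          rw [Finset.insertNone_eraseNone, Finset.insert_eq_self.mpr hn]
        refine ⟨s.eraseNone, ⟨⟨fun x hx y hy hxy => ?_, ?_⟩, fun x hx => ?_⟩, hi⟩
        · rw [Finset.mem_coe, Finset.mem_eraseNone] at hx hy
          exact hs hx hy (by simpa using hxy)
        · rw [← hi, Finset.card_insertNone] at hk
          omega
        · rw [Finset.mem_coe, Finset.mem_eraseNone] at hx
          exact hs (Finset.mem_coe.mpr hn) hx (by simp)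
      · left
        refine ⟨⟨hs, hk⟩, ?_⟩
        rintro (_ | x) hx
        · exact absurd hx hn
        · exact ⟨x, rfl⟩
    · rintro (h | ⟨t, ⟨⟨ht, hk⟩, hS⟩, rfl⟩)
      · exact h.1
      · refine ⟨?_, by rw [Finset.card_insertNone, hk]⟩
        rintro (_ | x) hx (_ | y) hy hxy
        · exact absurd rfl hxy
        · exact hS (Finset.mem_coe.mpr (Finset.some_mem_insertNone.mp hy))
        · exact hS (Finset.mem_coe.mpr (Finset.some_mem_insertNone.mp hx))
        · exact ht (Finset.mem_coe.mpr (Finset.some_mem_insertNone.mp hx))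
            (Finset.mem_coe.mpr (Finset.some_mem_insertNone.mp hy)) (by simpa using hxy)
  · rw [Set.disjoint_left]
    rintro s ⟨-, hs⟩ ⟨t, -, rfl⟩
    obtain ⟨x, hx⟩ := hs (Finset.mem_coe.mpr Finset.none_mem_insertNone)
    exact absurd hx (Option.some_ne_none x)

/-- The inclusion of an initial segment of a Turán graph. -/
def turanGraphCastLE {i j : ℕ} (h : i ≤ j) (r : ℕ) :
    SimpleGraph.turanGraph i r ↪g SimpleGraph.turanGraph j r where
  toFun := Fin.castLE h
  inj' := Fin.castLE_injective h
  map_rel_iff' := Iff.rfl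

theorem tc_le_of_embedding {V : Type} [Finite V] {G : SimpleGraph V} {n r : ℕ}
    (f : SimpleGraph.turanGraph n r ↪g G) (k : ℕ) : tc n k r ≤ (G.cliqueSet k).ncard := by
  rw [tc, ← ncard_cliqueSet_subset_range f k]
  exact Set.ncard_le_ncard (Set.sep_subset _ _) (Set.toFinite _)

theorem tc_mono {i j : ℕ} (h : i ≤ j) (k r : ℕ) : tc i k r ≤ tc j k r :=
  tc_le_of_embedding (turanGraphCastLE h r) k

theorem tc_eq_zero {n k : ℕ} (h : n < k) (r : ℕ) : tc n k r = 0 := by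
  rw [tc, Set.ncard_eq_zero (Set.toFinite _), Set.eq_empty_iff_forall_notMem]
  intro s hs
  have h1 := hs.card_eq
  have h2 := s.card_le_univ
  rw [Fintype.card_fin] at h2
  omega

theorem tc_zero (n r : ℕ) : tc n 0 r = 1 := by
  rw [tc, Set.ncard_eq_one]
  refine ⟨∅, ?_⟩
  ext s
  simp

theorem tc_self {n r : ℕ} (h : n ≤ r) : tc n n r = 1 := by
  rw [tc, Set.ncard_eq_one]
  refine ⟨Finset.univ, ?_⟩
  rw [SimpleGraph.turanGraph_eq_top.mpr (Or.inr h)]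
  ext s
  simp only [SimpleGraph.mem_cliqueSet_iff, SimpleGraph.isNClique_iff, Set.mem_singleton_iff]
  constructor
  · rintro ⟨-, hs⟩
    exact Finset.eq_univ_of_card s (by simpa using hs)
  · rintro rfl
    exact ⟨fun x _ y _ hxy => hxy, by simp⟩

/-- Deleting the residue class of `r` from `ℕ` modulo `r + 1`. -/
theorem skip_mod {r : ℕ} (hr : 0 < r) (i : ℕ) : (i + i / r) % (r + 1) = i % r := by
  have h := Nat.div_add_mod i r
  have h1 : i + i / r = i % r + (r + 1) * (i / r) := by nlinarith
  rw [h1, Nat.add_mul_mod_self_left, Nat.mod_eq_of_lt]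
  have := Nat.mod_lt i hr
  omega

theorem skip_lt {r i a : ℕ} (hr : 0 < r) (h : i < a - a / (r + 1)) : i + i / r < a := by
  have h1 := Nat.div_add_mod i r
  have h2 := Nat.div_add_mod a (r + 1)
  have h3 := Nat.mod_lt i hr
  have h4 := Nat.mod_lt a (Nat.succ_pos r)
  generalize i / r = q at *
  generalize a / (r + 1) = Q at *
  generalize i % r = t at *
  generalize a % (r + 1) = u at *
  rcases lt_trichotomy q Q with hq | rfl | hq
  · nlinarith
  · omega
  · have : i < r * Q + u := by
      have : a = r * Q + u + Q := by nlinarith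
      omega
    nlinarith

/-- `turanGraph b r` embeds in `turanGraph a (r + 1)` with its smallest part removed. -/
def turanGraphSkip {r a b : ℕ} (hr : 0 < r) (h : b ≤ a - a / (r + 1)) :
    SimpleGraph.turanGraph b r ↪g SimpleGraph.turanGraph a (r + 1) where
  toFun i := ⟨i + i / r, skip_lt hr (i.2.trans_le h)⟩
  inj' := by
    intro i j hij
    have hij : (i : ℕ) + i / r = j + j / r := congrArg Fin.val hij
    rcases lt_trichotomy (i : ℕ) j with hlt | heq | hlt
    · have := Nat.div_le_div_right (c := r) hlt.le
      omega
    · exact Fin.ext heq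
    · have := Nat.div_le_div_right (c := r) hlt.le
      omega
  map_rel_iff' := by
    intro i j
    change (i + i / r : ℕ) % (r + 1) ≠ (j + j / r : ℕ) % (r + 1) ↔ (i : ℕ) % r ≠ j % r
    rw [skip_mod hr, skip_mod hr]

/-- The cone over `turanGraph (b - b / (r + 1)) r` embeds in `turanGraph (b + 1) (r + 1)`. -/
theorem tc_cone_le {r : ℕ} (hr : 0 < r) (b k : ℕ) :
    tc (b - b / (r + 1)) k r ≤ tc (b + 1) (k + 1) (r + 1) := by
  let f : SimpleGraph.turanGraph (b - b / (r + 1)) r ↪g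
      SimpleGraph.turanGraph (b + 1) (r + 1) :=
    { toFun := fun i => ⟨i + i / r + 1, by have := skip_lt hr i.2; omega⟩
      inj' := by
        intro i j hij
        have hij : (i : ℕ) + i / r + 1 = j + j / r + 1 := congrArg Fin.val hij
        exact (turanGraphSkip hr le_rfl).injective (Fin.ext (Nat.succ_injective hij))
      map_rel_iff' := by
        intro i j
        have h : ∀ n : ℕ, (n + n / r + 1) % (r + 1) = n % r + 1 := by
          intro n
          have := Nat.mod_lt n hr
          rw [Nat.add_mod, skip_mod hr, Nat.mod_eq_of_lt (a := 1) (by omega)]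
          exact Nat.mod_eq_of_lt (by omega)
        change (i + i / r + 1 : ℕ) % (r + 1) ≠ (j + j / r + 1 : ℕ) % (r + 1) ↔
          (i : ℕ) % r ≠ j % r
        rw [h, h, Ne, Nat.add_right_cancel_iff] }
  have hf : ∀ i, ((f i : ℕ)) % (r + 1) ≠ 0 := by
    intro i
    have := Nat.mod_lt i hr
    change ((i : ℕ) + i / r + 1) % (r + 1) ≠ 0
    rw [Nat.add_mod, skip_mod hr, Nat.mod_eq_of_lt (a := 1) (by omega),
      Nat.mod_eq_of_lt (by omega)]
    omega
  rw [tc, ← ncard_cliqueSet_subset_range f k]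
  have h0 : ∀ s : Finset (Fin (b + 1)), (s : Set (Fin (b + 1))) ⊆ Set.range f → 0 ∉ s := by
    intro s hs h
    obtain ⟨i, hi⟩ := hs h
    exact hf i (by rw [hi]; simp)
  refine Set.ncard_le_ncard_of_injOn (insert 0) ?_ ?_ (Set.toFinite _)
  · rintro s ⟨hs, hr'⟩
    refine hs.insert fun x hx => ?_
    obtain ⟨i, rfl⟩ := hr' hx
    have := hf i
    simpa [SimpleGraph.turanGraph] using this.symm
  · rintro s ⟨-, hs⟩ t ⟨-, ht⟩ hst
    rw [← Finset.erase_insert (h0 s hs), ← Finset.erase_insert (h0 t ht)]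
    exact congrArg (fun u => Finset.erase u 0) hst

/-- There is an `(r + 1)`-coloured graph with `x` cliques on `k` vertices and `y` cliques on `p`
vertices, containing an induced `turanGraph b r` that avoids the last colour. -/
def TuranRealizable (b r k p x y : ℕ) : Prop :=
  ∃ (V : Type) (_ : Finite V) (G : SimpleGraph V) (f : SimpleGraph.turanGraph b r ↪g G)
    (C : V → ℕ), (∀ v, C v ≤ r) ∧ (∀ i, C (f i) < r) ∧ (∀ u v, G.Adj u v → C u ≠ C v) ∧
    (G.cliqueSet k).ncard = x ∧ (G.cliqueSet p).ncard = y

namespace TuranRealizable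

theorem turan {r a b : ℕ} (hr : 0 < r) (h : b ≤ a - a / (r + 1)) (k p : ℕ) :
    TuranRealizable b r k p (tc a k (r + 1)) (tc a p (r + 1)) := by
  refine ⟨Fin a, inferInstance, SimpleGraph.turanGraph a (r + 1), turanGraphSkip hr h,
    fun v => v % (r + 1), fun v => Nat.lt_succ_iff.mp (Nat.mod_lt _ (Nat.succ_pos r)),
    fun i => ?_, fun u v huv => huv, rfl, rfl⟩
  change ((i : ℕ) + i / r) % (r + 1) < r
  rw [skip_mod hr]
  exact Nat.mod_lt _ hr

theorem add_tc {b r k p x y j : ℕ} (h : TuranRealizable b r (k + 1) (p + 1) x y) (hj : j ≤ b) :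
    TuranRealizable b r (k + 1) (p + 1) (x + tc j k r) (y + tc j p r) := by
  obtain ⟨V, _, G, f, C, hC, hCf, hCG, rfl, rfl⟩ := h
  let g : SimpleGraph.turanGraph j r ↪g G := f.comp (turanGraphCastLE hj r)
  have hCg : ∀ v ∈ Set.range g, C v < r := by
    rintro _ ⟨i, rfl⟩
    exact hCf _
  refine ⟨Option V, inferInstance, G.addVertex (Set.range g),
    (G.someEmbedding _).comp f, fun v => v.elim r C, ?_, hCf, ?_, ?_, ?_⟩
  · rintro (_ | v)
    · exact le_rfl
    · exact hC v
  · rintro (_ | u) (_ | v) huv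
    · exact huv.elim
    · exact (hCg v huv).ne'
    · exact (hCg u huv).ne
    · exact hCG u v huv
  · rw [ncard_cliqueSet_addVertex, ncard_cliqueSet_subset_range g, tc]
  · rw [ncard_cliqueSet_addVertex, ncard_cliqueSet_subset_range g, tc]

theorem add_right {b r k p x y : ℕ} (h : TuranRealizable b r (k + 1) (p + 1) x y)
    (hpk : p < k) (hpr : p ≤ r) (hpb : p ≤ b) (n : ℕ) :
    TuranRealizable b r (k + 1) (p + 1) x (y + n) := by
  induction n with
  | zero => exact h
  | succ n ih =>
    have := ih.add_tc hpb
    rwa [tc_eq_zero hpk, tc_self hpr] at this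

theorem add_dprk {b r k p m : ℕ} (hk : 0 < k) (hkr : k ≤ r) (hm : m < tc (b + 1) k r) :
    ∀ {x y : ℕ}, TuranRealizable b r (k + 1) (p + 1) x y →
      TuranRealizable b r (k + 1) (p + 1) (x + m) (y + dprk (p + 1) (r + 1) (k + 1) m) := by
  induction m using Nat.strong_induction_on with
  | _ m ih =>
  intro x y h
  cases m with
  | zero => simpa [dprk] using h
  | succ m =>
    have hbound : k ≤ (m + 1 + 2) * (r + 1) := by nlinarith
    have hself : tc k k r ≤ m + 1 := by rw [tc_self hkr]; omega
    have hle : tc (jkr (r + 1) (k + 1) (m + 1)) k r ≤ m + 1 :=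
      Nat.findGreatest_spec (P := fun n => tc n k r ≤ m + 1) hbound hself
    have hkj : k ≤ jkr (r + 1) (k + 1) (m + 1) :=
      Nat.le_findGreatest (P := fun n => tc n k r ≤ m + 1) hbound hself
    have hpos : 1 ≤ tc (jkr (r + 1) (k + 1) (m + 1)) k r :=
      (tc_self hkr).symm.le.trans (tc_mono hkj k r)
    have hjb : jkr (r + 1) (k + 1) (m + 1) ≤ b := by
      by_contra! hlt
      have := tc_mono (Nat.succ_le_of_lt hlt) k r
      rw [Nat.succ_eq_add_one] at this
      omega
    have h2 := ih (m + 1 - tc (jkr (r + 1) (k + 1) (m + 1)) k r) (by omega) (by omega)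
      (h.add_tc hjb)
    rw [dprk]
    simp only [Nat.add_sub_cancel]
    rw [max_eq_right hpos]
    convert h2 using 1 <;> omega

theorem exists_graph {b r k p x y : ℕ} (h : TuranRealizable b r k p x y) :
    ∃ (n : ℕ) (G : SimpleGraph (Fin n)),
      G.CliqueFree (r + 2) ∧ (G.cliqueSet k).ncard = x ∧ (G.cliqueSet p).ncard = y := by
  obtain ⟨V, _, G, f, C, hC, -, hCG, rfl, rfl⟩ := h
  obtain ⟨n, ⟨e⟩⟩ := Finite.exists_equiv_fin V
  let g : G.comap e.symm ≃g G := SimpleGraph.Iso.comap e.symm G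
  have hcard : ∀ i, ((G.comap e.symm).cliqueSet i).ncard = (G.cliqueSet i).ncard := by
    intro i
    rw [← ncard_cliqueSet_subset_range g.toEmbedding i]
    congr 1
    ext s
    refine ⟨fun hs => hs.1, fun hs => ⟨hs, fun v _ => ⟨e v, ?_⟩⟩⟩
    exact e.symm_apply_apply v
  refine ⟨n, G.comap e.symm, ?_, hcard k, hcard p⟩
  have hcol : (G.comap e.symm).Colorable (r + 1) :=
    ⟨SimpleGraph.Coloring.mk
      (fun i => (⟨C (e.symm i), Nat.lt_succ_of_le (hC _)⟩ : Fin (r + 1)))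
      fun {u v} huv heq => hCG _ _ huv (congrArg Fin.val heq)⟩
  exact hcol.cliqueFree (Nat.lt_succ_self _)

end TuranRealizable

/-- Let `r, k, p, v, w` be positive integers with `r ≥ k > p`.  Write
`v = C(a, k)_r + C(b, k-1)_{r-1} + m` with `a − ⌊a/r⌋ > b` and
`C(b − ⌊b/(r-1)⌋, k-2)_{r-2} > m ≥ 0` (the unique such representation).  If
`w ≥ C(a, p)_r + C(b, p-1)_{r-1} + d_{p,r}^k(m)`, then there exists a finite simple graph
with no clique on `r+1` vertices whose number of cliques on `k` vertices is exactly `v` and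
whose number of cliques on `p` vertices is exactly `w`. -/
theorem stmt_11 (r k p v w a b m : ℕ) (hp : 0 < p) (hpk : p < k) (hkr : k ≤ r)
    (hv : 0 < v) (hw : 0 < w)
    (hrep : v = tc a k r + tc b (k - 1) (r - 1) + m)
    (hab : b < a - a / r)
    (hm : m < tc (b - b / (r - 1)) (k - 2) (r - 2))
    (hwge : tc a p r + tc b (p - 1) (r - 1) + dprk p r k m ≤ w) :
    ∃ (n : ℕ) (G : SimpleGraph (Fin n)),
      G.CliqueFree (r + 1) ∧ (G.cliqueSet k).ncard = v ∧ (G.cliqueSet p).ncard = w := by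
  obtain ⟨p, rfl⟩ := Nat.exists_eq_add_of_lt hp
  obtain ⟨k, rfl⟩ : ∃ i, k = i + 1 := ⟨k - 1, by omega⟩
  obtain ⟨r, rfl⟩ : ∃ i, r = i + 1 := ⟨r - 1, by omega⟩
  simp only [Nat.zero_add, Nat.add_sub_cancel] at hrep hm hwge hpk hp ⊢
  have hk : k - 1 ≤ b := by
    by_contra! hlt
    rw [tc_eq_zero (by have := Nat.sub_le b (b / r); omega)] at hm
    omega
  have hm' : m < tc (b + 1) k r := by
    rcases Nat.lt_or_ge 1 r with hr | hr
    · obtain ⟨s, rfl⟩ : ∃ i, r = i + 1 := ⟨r - 1, by omega⟩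
      obtain ⟨l, rfl⟩ : ∃ i, k = i + 1 := ⟨k - 1, by omega⟩
      exact hm.trans_le (tc_cone_le (by omega) b l)
    · obtain ⟨rfl, rfl⟩ : k = 1 ∧ r = 1 := by omega
      have h1 : tc 1 1 1 ≤ tc (b + 1) 1 1 := tc_mono (by omega) 1 1
      rw [tc_self le_rfl] at h1
      have h2 : m < 1 := by simpa [tc_zero] using hm
      omega
  obtain ⟨n, rfl⟩ := Nat.exists_eq_add_of_le hwge
  rw [hrep]
  exact ((((TuranRealizable.turan (by omega) hab.le (k + 1) (p + 1)).add_tc le_rfl).add_dprk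
    (by omega) (by omega) hm').add_right (by omega) (by omega) (by omega) n).exists_graph
end
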